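/- Monogamy-of-entanglement bound for composed path-recording operators on overlapping registers. For all n, λ, t ∈ ℕ, with V_L¹ the left path-recording operator of system 1 (acting on registers A,B and databases S₁,T₁) and V_R² the right path-recording operator of system 2 (acting on registers B,C and databases S₂,T₂), it holds that ‖ V_L^{1,†} · V_R^{2} · Π_{≤t} ‖_op ≤ t² / 2^{λ}. -/

import Mathlib

noncomputable section
open MeasureTheory Matrix
open scoped ComplexOrder

/-- `n`-bit strings, indexing the computational basis of an `n`-qubit register. -/
abbrev BS (n : ℕ) := Fin n → Bool

/-- ℓ²-space with orthonormal basis indexed by `ι`. -/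
abbrev QState (ι : Type) := lp (fun _ : ι => ℂ) 2

/-- basis vector (ket) labelled by `i`. -/
def ket {ι : Type} (i : ι) : QState ι :=
  letI := Classical.decEq ι
  lp.single 2 i 1

/-- inverse of a relation. -/
def dbInv {σ : Type} (R : Multiset (σ × σ)) : Multiset (σ × σ) := R.map fun p => (p.2, p.1)

/-- image (set of second coordinates) of a relation. -/
def dbIm {σ : Type} [DecidableEq σ] (R : Multiset (σ × σ)) : Finset σ :=
  (R.map Prod.snd).toFinset

/-- The index set of the computational basis of the purified space for the
gluing construction (without auxiliary register): the query registers
`A ⊗ B ⊗ C` together with the six relation databases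
`(L₁,R₁), (L₂,R₂), (L₃,R₃)`; systems 1 and 3 record relations on `AB`-labels
and system 2 records relations on `BC`-labels. -/
abbrev GluedIdx (n lam : ℕ) :=
  (BS n × BS lam × BS n) ×
    ((Multiset ((BS n × BS lam) × (BS n × BS lam)) ×
      Multiset ((BS n × BS lam) × (BS n × BS lam))) ×
     (Multiset ((BS lam × BS n) × (BS lam × BS n)) ×
      Multiset ((BS lam × BS n) × (BS lam × BS n))) ×
     (Multiset ((BS n × BS lam) × (BS n × BS lam)) ×
      Multiset ((BS n × BS lam) × (BS n × BS lam))))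

/-- operators on the purified space. -/
abbrev GOp (n lam : ℕ) := QState (GluedIdx n lam) →L[ℂ] QState (GluedIdx n lam)

/-- `V` is the left path-recording operator of system 1 (acting on registers
`A,B` and the databases `S₁ = L₁`, `T₁ = R₁`). -/
def IsVL1 {n lam : ℕ} (V : GOp n lam) : Prop :=
  ∀ (a : BS n) (b : BS lam) (c : BS n)
    (L1 R1 : Multiset ((BS n × BS lam) × (BS n × BS lam)))
    (L2 R2 : Multiset ((BS lam × BS n) × (BS lam × BS n)))
    (L3 R3 : Multiset ((BS n × BS lam) × (BS n × BS lam))),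
    V (ket ((a, b, c), ((L1, R1), (L2, R2), (L3, R3)))) =
      (↑(Real.sqrt ((2 : ℝ) ^ (n + lam) - (dbIm (L1 + dbInv R1)).card)) : ℂ)⁻¹ •
        ∑ y ∈ (dbIm (L1 + dbInv R1))ᶜ,
          ket ((y.1, y.2, c), ((((a, b), y) ::ₘ L1, R1), (L2, R2), (L3, R3)))

/-- `V` is the right path-recording operator of system 1. -/
def IsVR1 {n lam : ℕ} (V : GOp n lam) : Prop :=
  ∀ (a : BS n) (b : BS lam) (c : BS n)
    (L1 R1 : Multiset ((BS n × BS lam) × (BS n × BS lam)))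
    (L2 R2 : Multiset ((BS lam × BS n) × (BS lam × BS n)))
    (L3 R3 : Multiset ((BS n × BS lam) × (BS n × BS lam))),
    V (ket ((a, b, c), ((L1, R1), (L2, R2), (L3, R3)))) =
      (↑(Real.sqrt ((2 : ℝ) ^ (n + lam) - (dbIm (R1 + dbInv L1)).card)) : ℂ)⁻¹ •
        ∑ y ∈ (dbIm (R1 + dbInv L1))ᶜ,
          ket ((y.1, y.2, c), ((L1, ((a, b), y) ::ₘ R1), (L2, R2), (L3, R3)))

/-- `V` is the left path-recording operator of system 2 (acting on registers
`B,C` and the databases `S₂ = L₂`, `T₂ = R₂`). -/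
def IsVL2 {n lam : ℕ} (V : GOp n lam) : Prop :=
  ∀ (a : BS n) (b : BS lam) (c : BS n)
    (L1 R1 : Multiset ((BS n × BS lam) × (BS n × BS lam)))
    (L2 R2 : Multiset ((BS lam × BS n) × (BS lam × BS n)))
    (L3 R3 : Multiset ((BS n × BS lam) × (BS n × BS lam))),
    V (ket ((a, b, c), ((L1, R1), (L2, R2), (L3, R3)))) =
      (↑(Real.sqrt ((2 : ℝ) ^ (n + lam) - (dbIm (L2 + dbInv R2)).card)) : ℂ)⁻¹ •
        ∑ y ∈ (dbIm (L2 + dbInv R2))ᶜ,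
          ket ((a, y.1, y.2), ((L1, R1), (((b, c), y) ::ₘ L2, R2), (L3, R3)))

/-- `V` is the right path-recording operator of system 2. -/
def IsVR2 {n lam : ℕ} (V : GOp n lam) : Prop :=
  ∀ (a : BS n) (b : BS lam) (c : BS n)
    (L1 R1 : Multiset ((BS n × BS lam) × (BS n × BS lam)))
    (L2 R2 : Multiset ((BS lam × BS n) × (BS lam × BS n)))
    (L3 R3 : Multiset ((BS n × BS lam) × (BS n × BS lam))),
    V (ket ((a, b, c), ((L1, R1), (L2, R2), (L3, R3)))) =
      (↑(Real.sqrt ((2 : ℝ) ^ (n + lam) - (dbIm (R2 + dbInv L2)).card)) : ℂ)⁻¹ •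
        ∑ y ∈ (dbIm (R2 + dbInv L2))ᶜ,
          ket ((a, y.1, y.2), ((L1, R1), (L2, ((b, c), y) ::ₘ R2), (L3, R3)))

/-- `V` is the left path-recording operator of system 3 (acting on registers
`A,B` and the databases `S₃ = L₃`, `T₃ = R₃`). -/
def IsVL3 {n lam : ℕ} (V : GOp n lam) : Prop :=
  ∀ (a : BS n) (b : BS lam) (c : BS n)
    (L1 R1 : Multiset ((BS n × BS lam) × (BS n × BS lam)))
    (L2 R2 : Multiset ((BS lam × BS n) × (BS lam × BS n)))
    (L3 R3 : Multiset ((BS n × BS lam) × (BS n × BS lam))),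
    V (ket ((a, b, c), ((L1, R1), (L2, R2), (L3, R3)))) =
      (↑(Real.sqrt ((2 : ℝ) ^ (n + lam) - (dbIm (L3 + dbInv R3)).card)) : ℂ)⁻¹ •
        ∑ y ∈ (dbIm (L3 + dbInv R3))ᶜ,
          ket ((y.1, y.2, c), ((L1, R1), (L2, R2), (((a, b), y) ::ₘ L3, R3)))

/-- `V` is the right path-recording operator of system 3. -/
def IsVR3 {n lam : ℕ} (V : GOp n lam) : Prop :=
  ∀ (a : BS n) (b : BS lam) (c : BS n)
    (L1 R1 : Multiset ((BS n × BS lam) × (BS n × BS lam)))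
    (L2 R2 : Multiset ((BS lam × BS n) × (BS lam × BS n)))
    (L3 R3 : Multiset ((BS n × BS lam) × (BS n × BS lam))),
    V (ket ((a, b, c), ((L1, R1), (L2, R2), (L3, R3)))) =
      (↑(Real.sqrt ((2 : ℝ) ^ (n + lam) - (dbIm (R3 + dbInv L3)).card)) : ℂ)⁻¹ •
        ∑ y ∈ (dbIm (R3 + dbInv L3))ᶜ,
          ket ((y.1, y.2, c), ((L1, R1), (L2, R2), (L3, ((a, b), y) ::ₘ R3)))

/-- `P` is the orthogonal projection onto the span of basis states whose six
databases have total size at most `t`. -/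
def IsPt {n lam : ℕ} (t : ℕ) (P : GOp n lam) : Prop :=
  ∀ (x : BS n × BS lam × BS n)
    (L1 R1 : Multiset ((BS n × BS lam) × (BS n × BS lam)))
    (L2 R2 : Multiset ((BS lam × BS n) × (BS lam × BS n)))
    (L3 R3 : Multiset ((BS n × BS lam) × (BS n × BS lam))),
    P (ket (x, ((L1, R1), (L2, R2), (L3, R3)))) =
      if Multiset.card L1 + Multiset.card R1 + Multiset.card L2 + Multiset.card R2 +
          Multiset.card L3 + Multiset.card R3 ≤ t then
        ket (x, ((L1, R1), (L2, R2), (L3, R3)))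
      else 0

/-- The coordinate of a vector at `i` is its inner product with the basis vector `ket i`. -/
lemma inner_ket_left {ι : Type} (i : ι) (f : QState ι) : inner ℂ (ket i) f = f i := by
  classical
  simp [ket, lp.inner_single_left]

open Classical in
lemma inner_ket_ket {ι : Type} (i j : ι) :
    inner ℂ (ket i : QState ι) (ket j) = if i = j then 1 else 0 := by
  rw [inner_ket_left, ket, lp.single_apply, Pi.single_apply]

lemma hasSum_smul_ket {ι : Type} (z : QState ι) : HasSum (fun i => z i • ket i) z := by
  classical
  convert lp.hasSum_single (p := 2) (by simp) z using 2 with i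
  rw [ket, ← lp.single_smul]
  simp

lemma norm_sum_smul_ket_sq {ι : Type} (z : ι → ℂ) (s : Finset ι) :
    ‖∑ i ∈ s, z i • (ket i : QState ι)‖ ^ 2 = ∑ i ∈ s, ‖z i‖ ^ 2 := by
  classical
  have h := lp.norm_sum_single (E := fun _ : ι => ℂ) (p := 2) (by simp) z s
  have hk : ∀ i, z i • (ket i : QState ι) = lp.single 2 i (z i) := by
    intro i
    rw [ket, ← lp.single_smul]
    simp
  simpa [hk] using h

/-- Schur test for a bounded operator on `ℓ²`. -/
lemma opNorm_le_of_sum_norm_inner_ket_le {ι : Type} (T : QState ι →L[ℂ] QState ι) {C : ℝ}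
    (hC : 0 ≤ C)
    (hcol : ∀ (i : ι) (s : Finset ι), ∑ j ∈ s, ‖inner ℂ (ket j) (T (ket i))‖ ≤ C)
    (hrow : ∀ (j : ι) (s : Finset ι), ∑ i ∈ s, ‖inner ℂ (ket j) (T (ket i))‖ ≤ C) :
    ‖T‖ ≤ C := by
  have hfin : ∀ (z : ι → ℂ) (s : Finset ι),
      ‖T (∑ i ∈ s, z i • ket i)‖ ≤ C * ‖∑ i ∈ s, z i • (ket i : QState ι)‖ := by
    intro z s
    refine lp.norm_le_of_forall_sum_le (by simp) (by positivity) fun J => ?_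
    have hcoord : ∀ j, ‖(T (∑ i ∈ s, z i • ket i)) j‖ ^ 2 ≤
        C * ∑ i ∈ s, ‖inner ℂ (ket j) (T (ket i))‖ * ‖z i‖ ^ 2 := by
      intro j
      have h1 : ‖(T (∑ i ∈ s, z i • ket i)) j‖ ≤
          ∑ i ∈ s, ‖inner ℂ (ket j) (T (ket i))‖ * ‖z i‖ := by
        rw [← inner_ket_left, map_sum, inner_sum]
        refine (norm_sum_le _ _).trans (le_of_eq (Finset.sum_congr rfl fun i _ => ?_))
        rw [map_smul, inner_smul_right, norm_mul, mul_comm]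
      calc _ ≤ (∑ i ∈ s, ‖inner ℂ (ket j) (T (ket i))‖ * ‖z i‖) ^ 2 := by gcongr
        _ ≤ (∑ i ∈ s, ‖inner ℂ (ket j) (T (ket i))‖) *
            ∑ i ∈ s, ‖inner ℂ (ket j) (T (ket i))‖ * ‖z i‖ ^ 2 :=
          Finset.sum_sq_le_sum_mul_sum_of_sq_le_mul s (fun _ _ => by positivity)
            (fun _ _ => by positivity) (fun _ _ => le_of_eq (by ring))
        _ ≤ _ := by
          gcongr
          exact hrow j s
    simp only [ENNReal.toReal_ofNat, Real.rpow_ofNat]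
    rw [mul_pow, norm_sum_smul_ket_sq]
    calc _ ≤ ∑ j ∈ J, C * ∑ i ∈ s, ‖inner ℂ (ket j) (T (ket i))‖ * ‖z i‖ ^ 2 :=
          Finset.sum_le_sum fun j _ => hcoord j
      _ = C * ∑ i ∈ s, (∑ j ∈ J, ‖inner ℂ (ket j) (T (ket i))‖) * ‖z i‖ ^ 2 := by
          rw [← Finset.mul_sum, Finset.sum_comm]
          simp_rw [Finset.sum_mul]
      _ ≤ C * ∑ i ∈ s, C * ‖z i‖ ^ 2 := by
          gcongr with i _
          exact hcol i J
      _ = _ := by rw [← Finset.mul_sum]; ring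
  refine T.opNorm_le_bound hC fun z => ?_
  have hz : Filter.Tendsto (fun s : Finset ι => ∑ i ∈ s, z i • (ket i : QState ι))
      Filter.atTop (nhds z) := hasSum_smul_ket z
  exact le_of_tendsto_of_tendsto' ((T.continuous.tendsto z).comp hz).norm
    (hz.norm.const_mul C) fun s => hfin _ s

/-- A sparse operator on `ℓ²` with entries at most `ε` and at most `K` nonzero entries in each row
and column has norm at most `K * ε`. -/
lemma opNorm_le_of_sparse {ι : Type} (T : QState ι →L[ℂ] QState ι) {K : ℕ} {ε : ℝ} (hε : 0 ≤ ε)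
    (hentry : ∀ i j, ‖inner ℂ (ket j) (T (ket i))‖ ≤ ε)
    (hcol : ∀ i, ∃ F : Finset ι, F.card ≤ K ∧ ∀ j, inner ℂ (ket j) (T (ket i)) ≠ 0 → j ∈ F)
    (hrow : ∀ j, ∃ F : Finset ι, F.card ≤ K ∧ ∀ i, inner ℂ (ket j) (T (ket i)) ≠ 0 → i ∈ F) :
    ‖T‖ ≤ K * ε := by
  classical
  have key : ∀ (f : ι → ℂ) (s : Finset ι), (∀ i, ‖f i‖ ≤ ε) →
      (∃ F : Finset ι, F.card ≤ K ∧ ∀ i, f i ≠ 0 → i ∈ F) → ∑ i ∈ s, ‖f i‖ ≤ K * ε := by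
    rintro f s hf ⟨F, hF, hsupp⟩
    have hsub : s.filter (fun i => f i ≠ 0) ⊆ F := fun i hi =>
      hsupp i (Finset.mem_filter.1 hi).2
    calc ∑ i ∈ s, ‖f i‖ = ∑ i ∈ s with f i ≠ 0, ‖f i‖ := by
          refine (Finset.sum_filter_of_ne fun i _ hi => ?_).symm
          simpa using hi
      _ ≤ (s.filter (fun i => f i ≠ 0)).card • ε :=
          Finset.sum_le_card_nsmul _ _ _ fun i _ => hf i
      _ ≤ K * ε := by
          rw [nsmul_eq_mul]
          gcongr
          exact (Finset.card_le_card hsub).trans hF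
  exact opNorm_le_of_sum_norm_inner_ket_le T (by positivity)
    (fun i s => key _ s (hentry i) (hcol i)) (fun j s => key _ s (fun i => hentry i j) (hrow j))

open Classical in
/-- Two families of basis vectors that meet in at most one pair have sums with overlap at most
one. -/
lemma norm_inner_sum_ket_le_one {ι α β : Type} (s : Finset α) (s' : Finset β) (f : α → ι)
    (g : β → ι)
    (huniq : ∀ y₁ ∈ s, ∀ z₁ ∈ s', ∀ y₂ ∈ s, ∀ z₂ ∈ s', f y₁ = g z₁ → f y₂ = g z₂ →
      y₁ = y₂ ∧ z₁ = z₂) :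
    ‖inner ℂ (∑ y ∈ s, (ket (f y) : QState ι)) (∑ z ∈ s', ket (g z))‖ ≤ 1 := by
  simp_rw [sum_inner, inner_sum, inner_ket_ket]
  rw [← Finset.sum_product', Finset.sum_boole, Complex.norm_natCast, Nat.cast_le_one,
    Finset.card_le_one]
  rintro ⟨y₁, z₁⟩ h₁ ⟨y₂, z₂⟩ h₂
  simp only [Finset.mem_filter, Finset.mem_product] at h₁ h₂
  obtain ⟨hy, hz⟩ := huniq y₁ h₁.1.1 z₁ h₁.1.2 y₂ h₂.1.1 z₂ h₂.1.2 h₁.2 h₂.2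
  rw [hy, hz]

lemma exists_eq_of_inner_sum_ket_ne_zero {ι α β : Type} {s : Finset α} {s' : Finset β}
    {f : α → ι} {g : β → ι}
    (h : inner ℂ (∑ y ∈ s, (ket (f y) : QState ι)) (∑ z ∈ s', ket (g z)) ≠ 0) :
    ∃ y ∈ s, ∃ z ∈ s', f y = g z := by
  classical
  contrapose! h
  simp_rw [sum_inner, inner_sum, inner_ket_ket]
  exact Finset.sum_eq_zero fun y hy => Finset.sum_eq_zero fun z hz => if_neg (h y hy z hz)

lemma card_dbIm_add_dbInv_le {σ : Type} [DecidableEq σ] (L R : Multiset (σ × σ)) :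
    (dbIm (L + dbInv R)).card ≤ Multiset.card L + Multiset.card R := by
  refine (Multiset.toFinset_card_le _).trans ?_
  simp [dbInv]

/-- The squared normalisation of a path-recording step is at most `t / N` whenever fewer than
`min t N` labels are excluded. -/
lemma inv_sqrt_sub_le {N t : ℝ} {u : ℕ} (hN : (u : ℝ) + 1 ≤ N) (ht : (u : ℝ) + 1 ≤ t) :
    (Real.sqrt (N - u))⁻¹ ≤ Real.sqrt (t / N) := by
  have hu : (0 : ℝ) ≤ u := u.cast_nonneg
  rw [← Real.sqrt_inv]
  apply Real.sqrt_le_sqrt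
  rw [inv_eq_one_div, div_le_div_iff₀ (by linarith) (by linarith)]
  nlinarith [mul_nonneg hu (by linarith : (0 : ℝ) ≤ N - u - 1),
    mul_nonneg (by linarith : (0 : ℝ) ≤ t - u - 1) (by linarith : (0 : ℝ) ≤ N - u)]

lemma card_add_one_le_of_mem_compl {σ : Type} [Fintype σ] [DecidableEq σ] {s : Finset σ} {y : σ}
    (hy : y ∈ sᶜ) : s.card + 1 ≤ Fintype.card σ := by
  have := Finset.card_pos.2 ⟨y, hy⟩
  have := Finset.card_add_card_compl s
  omega

/-- The total size of the six databases of a basis label. -/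
def dbSize {n lam : ℕ} (i : GluedIdx n lam) : ℕ :=
  Multiset.card i.2.1.1 + Multiset.card i.2.1.2 + Multiset.card i.2.2.1.1 +
    Multiset.card i.2.2.1.2 + Multiset.card i.2.2.2.1 + Multiset.card i.2.2.2.2

/-- `PathRel t i j` says that the step of `V_R²` from `i` and the step of `V_L¹` from `j` can reach
the same basis label, the size of `i` being at most `t`. -/
def PathRel {n lam : ℕ} (t : ℕ) (i j : GluedIdx n lam) : Prop :=
  dbSize i ≤ t ∧ ∃ b' : BS lam,
    i.2.1.1 = ((j.1.1, j.1.2.1), (i.1.1, b')) ::ₘ j.2.1.1 ∧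
    j.2.2.1.2 = ((i.1.2.1, i.1.2.2), (b', j.1.2.2)) ::ₘ i.2.2.1.2 ∧
    i.2.1.2 = j.2.1.2 ∧ i.2.2.1.1 = j.2.2.1.1 ∧ i.2.2.2 = j.2.2.2

lemma exists_finset_of_pathRel_left {n lam : ℕ} (t : ℕ) (i : GluedIdx n lam) :
    ∃ F : Finset (GluedIdx n lam), F.card ≤ t * 2 ^ n ∧ ∀ j, PathRel t i j → j ∈ F := by
  classical
  by_cases hi : dbSize i ≤ t
  · obtain ⟨⟨a, b, c⟩, ⟨L1, R1⟩, ⟨L2, R2⟩, ⟨L3, R3⟩⟩ := i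
    refine ⟨(L1.toFinset ×ˢ (Finset.univ : Finset (BS n))).image fun q =>
      ((q.1.1.1, q.1.1.2, q.2), ((L1.erase q.1, R1),
        (L2, ((b, c), (q.1.2.2, q.2)) ::ₘ R2), (L3, R3))), ?_, ?_⟩
    · refine Finset.card_image_le.trans ?_
      rw [Finset.card_product]
      have := Multiset.toFinset_card_le L1
      simp only [dbSize] at hi
      have hL : L1.toFinset.card ≤ t := by omega
      simpa using hL
    · rintro ⟨⟨a'', b'', c'⟩, ⟨L1', R1'⟩, ⟨L2', R2'⟩, ⟨L3', R3'⟩⟩ ⟨-, b', h1, h2, h3, h4, h5⟩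
      simp only at h1 h2 h3 h4 h5
      subst h1 h2 h3 h4
      cases h5
      refine Finset.mem_image.2 ⟨(((a'', b''), (a, b')), c'), by simp, ?_⟩
      simp
  · exact ⟨∅, by simp, fun j hj => absurd hj.1 hi⟩

lemma exists_finset_of_pathRel_right {n lam : ℕ} (t : ℕ) (j : GluedIdx n lam) :
    ∃ F : Finset (GluedIdx n lam), F.card ≤ t * 2 ^ n ∧ ∀ i, PathRel t i j → i ∈ F := by
  classical
  by_cases hj : Multiset.card j.2.2.1.2 ≤ t
  · obtain ⟨⟨a, b, c⟩, ⟨L1, R1⟩, ⟨L2, R2⟩, ⟨L3, R3⟩⟩ := j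
    refine ⟨(R2.toFinset ×ˢ (Finset.univ : Finset (BS n))).image fun q =>
      ((q.2, q.1.1.1, q.1.1.2), ((((a, b), (q.2, q.1.2.1)) ::ₘ L1, R1),
        (L2, R2.erase q.1), (L3, R3))), ?_, ?_⟩
    · refine Finset.card_image_le.trans ?_
      rw [Finset.card_product]
      have hR : R2.toFinset.card ≤ t := (Multiset.toFinset_card_le R2).trans hj
      simpa using hR
    · rintro ⟨⟨a', b'', c'⟩, ⟨L1', R1'⟩, ⟨L2', R2'⟩, ⟨L3', R3'⟩⟩ ⟨-, b', h1, h2, h3, h4, h5⟩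
      simp only at h1 h2 h3 h4 h5
      subst h1 h2 h3 h4
      cases h5
      refine Finset.mem_image.2 ⟨(((b'', c'), (b', c)), a'), by simp, ?_⟩
      simp
  · refine ⟨∅, by simp, fun i hi => absurd ?_ hj⟩
    obtain ⟨hsize, b', h1, h2, -⟩ := hi
    rw [h2]
    simp only [dbSize, h1, Multiset.card_cons] at hsize ⊢
    omega

/-- The matrix entries of `V_L^{1,†} V_R² Π_{≤t}` are at most `t / 2^(n+λ)` and supported on
`PathRel t`. -/
lemma inner_ket_adjoint_mul_mul_ket {n lam t : ℕ} {VL1 VR2 Pt : GOp n lam}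
    (hVL1 : IsVL1 VL1) (hVR2 : IsVR2 VR2) (hPt : IsPt t Pt) (i j : GluedIdx n lam)
    (hne : inner ℂ (ket j) ((ContinuousLinearMap.adjoint VL1 * VR2 * Pt) (ket i)) ≠ 0) :
    ‖inner ℂ (ket j) ((ContinuousLinearMap.adjoint VL1 * VR2 * Pt) (ket i))‖ ≤
      t / 2 ^ (n + lam) ∧ PathRel t i j := by
  obtain ⟨⟨a, b, c⟩, ⟨L1, R1⟩, ⟨L2, R2⟩, ⟨L3, R3⟩⟩ := i
  obtain ⟨⟨a', b', c'⟩, ⟨L1', R1'⟩, ⟨L2', R2'⟩, ⟨L3', R3'⟩⟩ := j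
  simp only [mul_apply_eq_comp, ContinuousLinearMap.adjoint_inner_right] at hne ⊢
  rw [hPt] at hne ⊢
  split_ifs at hne ⊢ with hsize
  swap
  · simp at hne
  rw [hVL1, hVR2, inner_smul_left, inner_smul_right] at hne ⊢
  have hne' := right_ne_zero_of_mul (right_ne_zero_of_mul hne)
  obtain ⟨y, hy, z, hz, hyz⟩ := exists_eq_of_inner_sum_ket_ne_zero hne'
  have hle := norm_inner_sum_ket_le_one (dbIm (L1' + dbInv R1'))ᶜ (dbIm (R2 + dbInv L2))ᶜ
    (fun y => (((y.1, y.2, c'), ((((a', b'), y) ::ₘ L1', R1'), (L2', R2'), (L3', R3'))) :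
      GluedIdx n lam))
    (fun z => ((a, z.1, z.2), ((L1, R1), (L2, ((b, c), z) ::ₘ R2), (L3, R3)))) (by
      rintro ⟨y₁, y₁'⟩ - ⟨z₁, z₁'⟩ - ⟨y₂, y₂'⟩ - ⟨z₂, z₂'⟩ - h₁ h₂
      simp only [Prod.mk.injEq] at h₁ h₂
      obtain ⟨⟨rfl, rfl, rfl⟩, -, ⟨-, h₁⟩, -⟩ := h₁
      obtain ⟨⟨rfl, rfl, rfl⟩, -, ⟨-, h₂⟩, -⟩ := h₂
      have := h₁.symm.trans h₂
      simp only [Multiset.cons_inj_left, Prod.mk.injEq, true_and, and_true] at this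
      simp [this])
  obtain ⟨y, y'⟩ := y
  obtain ⟨z, z'⟩ := z
  simp only [Prod.mk.injEq] at hyz
  obtain ⟨⟨rfl, rfl, rfl⟩, ⟨hL1, rfl⟩, ⟨rfl, hR2⟩, rfl, rfl⟩ := hyz
  refine ⟨?_, hsize, y', hL1.symm, hR2, rfl, rfl, rfl⟩
  have hcardL : Multiset.card L1 = Multiset.card L1' + 1 := by rw [← hL1]; simp
  have hu := card_dbIm_add_dbInv_le L1' R1'
  have hv := card_dbIm_add_dbInv_le R2 L2'
  have huN := card_add_one_le_of_mem_compl hy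
  have hvN := card_add_one_le_of_mem_compl hz
  have hcard₁ : Fintype.card (BS n × BS lam) = 2 ^ (n + lam) := by simp [pow_add]
  have hcard₂ : Fintype.card (BS lam × BS n) = 2 ^ (n + lam) := by simp [pow_add, mul_comm]
  rw [hcard₁] at huN
  rw [hcard₂] at hvN
  have hut : (dbIm (L1' + dbInv R1')).card + 1 ≤ t := by omega
  have hvt : (dbIm (R2 + dbInv L2')).card + 1 ≤ t := by omega
  have h₁ := inv_sqrt_sub_le (N := 2 ^ (n + lam)) (t := t) (by exact_mod_cast huN)
    (by exact_mod_cast hut)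
  have h₂ := inv_sqrt_sub_le (N := 2 ^ (n + lam)) (t := t) (by exact_mod_cast hvN)
    (by exact_mod_cast hvt)
  rw [norm_mul, norm_mul, RCLike.norm_conj, norm_inv, norm_inv, Complex.norm_real,
    Complex.norm_real, Real.norm_of_nonneg (Real.sqrt_nonneg _),
    Real.norm_of_nonneg (Real.sqrt_nonneg _)]
  calc _ ≤ Real.sqrt (t / 2 ^ (n + lam)) * (Real.sqrt (t / 2 ^ (n + lam)) * 1) := by gcongr
    _ = _ := by rw [mul_one, Real.mul_self_sqrt (by positivity)]

/-- **Monogamy-of-entanglement bound for composed path-recording operators on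
overlapping registers.**  For all `n, λ, t`, with `V_L¹` the left
path-recording operator of system 1 (acting on registers `A,B` and databases
`S₁,T₁`) and `V_R²` the right path-recording operator of system 2 (acting on
registers `B,C` and databases `S₂,T₂`),
`‖ V_L^{1,†} · V_R^{2} · Π_{≤t} ‖ ≤ t² / 2^λ`. -/
theorem monogamy_of_entanglement_bound (n lam t : ℕ)
    (VL1 VR2 Pt : GOp n lam)
    (hVL1 : IsVL1 VL1) (hVR2 : IsVR2 VR2) (hPt : IsPt t Pt) :
    ‖ContinuousLinearMap.adjoint VL1 * VR2 * Pt‖ ≤ (t : ℝ) ^ 2 / 2 ^ lam := by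
  have hsupp := inner_ket_adjoint_mul_mul_ket hVL1 hVR2 hPt
  have h := opNorm_le_of_sparse (ContinuousLinearMap.adjoint VL1 * VR2 * Pt) (K := t * 2 ^ n)
    (ε := t / 2 ^ (n + lam)) (by positivity) (fun i j => ?_) (fun i => ?_) (fun j => ?_)
  · refine h.trans (le_of_eq ?_)
    push_cast
    rw [pow_add]
    field_simp
  · by_cases hne : inner ℂ (ket j) ((ContinuousLinearMap.adjoint VL1 * VR2 * Pt) (ket i)) = 0
    · rw [hne, norm_zero]
      positivity
    · exact (hsupp i j hne).1
  · obtain ⟨F, hF, hmem⟩ := exists_finset_of_pathRel_left t i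
    exact ⟨F, hF, fun j hne => hmem j (hsupp i j hne).2⟩
  · obtain ⟨F, hF, hmem⟩ := exists_finset_of_pathRel_right t j
    exact ⟨F, hF, fun i hne => hmem i (hsupp i j hne).2⟩
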